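/- arXiv:1410.3608 — 5 statements merged into one kernel-verified Lean document; each statement's English description precedes it below -/
import Mathlib

section
/- Let (X,ρ,μ) be a space of homogeneous type with quasi-triangle constant κ. Then for all σ, σ' > κ, the classes A_∞^σ and A_∞^{σ'} contain exactly the same weights: A_∞^σ = A_∞^{σ'}. -/
open MeasureTheory ENNReal

namespace SHT

variable {X : Type*}

/-- The quasi-metric ball `B(x,r) = {y : ρ(x,y) < r}`. -/
def qball (ρ : X → X → ℝ) (x : X) (r : ℝ) : Set X := {y | ρ x y < r}

/-- `(X, ρ, μ)` is a space of homogeneous type with quasi-triangle constant `κ`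
and doubling constant `D`. -/
structure IsSHT [MeasurableSpace X] (ρ : X → X → ℝ) (μ : Measure X) (κ D : ℝ) : Prop where
  nonneg : ∀ x y, 0 ≤ ρ x y
  eq_zero_iff : ∀ x y, ρ x y = 0 ↔ x = y
  symm : ∀ x y, ρ x y = ρ y x
  one_le_kappa : 1 ≤ κ
  quasi_triangle : ∀ x y z, ρ x y ≤ κ * (ρ x z + ρ z y)
  ball_measurable : ∀ (x : X) (r : ℝ), MeasurableSet (qball ρ x r)
  ball_pos : ∀ (x : X) (r : ℝ), 0 < r → 0 < μ (qball ρ x r)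
  ball_lt_top : ∀ (x : X) (r : ℝ), μ (qball ρ x r) < ⊤
  doubling : ∀ (x : X) (r : ℝ), μ (qball ρ x (2 * r)) ≤ ENNReal.ofReal D * μ (qball ρ x r)

/-- A weight: a nonnegative (here `ℝ≥0∞`-valued) measurable, locally integrable function. -/
def IsWeight [MeasurableSpace X] (ρ : X → X → ℝ) (μ : Measure X) (w : X → ℝ≥0∞) : Prop :=
  Measurable w ∧ ∀ (x : X) (r : ℝ), ∫⁻ y in qball ρ x r, w y ∂μ < ⊤

/-- The non-centered Hardy-Littlewood maximal operator. -/
noncomputable def maximal [MeasurableSpace X] (ρ : X → X → ℝ) (μ : Measure X)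
    (f : X → ℝ≥0∞) (x : X) : ℝ≥0∞ :=
  ⨆ (z : X) (r : ℝ) (_ : 0 < r) (_ : x ∈ qball ρ z r),
    (μ (qball ρ z r))⁻¹ * ∫⁻ y in qball ρ z r, f y ∂μ

/-- The centered Hardy-Littlewood maximal operator. -/
noncomputable def cmaximal [MeasurableSpace X] (ρ : X → X → ℝ) (μ : Measure X)
    (f : X → ℝ≥0∞) (x : X) : ℝ≥0∞ :=
  ⨆ (r : ℝ) (_ : 0 < r), (μ (qball ρ x r))⁻¹ * ∫⁻ y in qball ρ x r, f y ∂μ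

/-- The average `⨍_E f dμ`. -/
noncomputable def avg [MeasurableSpace X] (μ : Measure X) (E : Set X) (f : X → ℝ≥0∞) : ℝ≥0∞ :=
  (μ E)⁻¹ * ∫⁻ y in E, f y ∂μ

/-- The `σ`-weak Fujii-Wilson `A_∞` inequality with constant `C`:
`∫_B M(1_B w) dμ ≤ C ⋅ w(σB)` for all balls `B`. -/
def AinftyIneq [MeasurableSpace X] (ρ : X → X → ℝ) (μ : Measure X) (σ : ℝ)
    (w : X → ℝ≥0∞) (C : ℝ≥0∞) : Prop :=
  ∀ (x : X) (r : ℝ), 0 < r →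
    ∫⁻ y in qball ρ x r, maximal ρ μ ((qball ρ x r).indicator w) y ∂μ
      ≤ C * ∫⁻ y in qball ρ x (σ * r), w y ∂μ

/-- Membership in the `σ`-weak `A_∞` class. -/
def MemAinfty [MeasurableSpace X] (ρ : X → X → ℝ) (μ : Measure X) (σ : ℝ)
    (w : X → ℝ≥0∞) : Prop :=
  ∃ C : ℝ≥0∞, C ≠ ⊤ ∧ AinftyIneq ρ μ σ w C

/-- The constant `[w]_∞^σ`: the least admissible constant. -/
noncomputable def ainftyConst [MeasurableSpace X] (ρ : X → X → ℝ) (μ : Measure X) (σ : ℝ)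
    (w : X → ℝ≥0∞) : ℝ≥0∞ :=
  sInf {C : ℝ≥0∞ | AinftyIneq ρ μ σ w C}

/-- Membership in the weak `A_∞` class: `w ∈ A_∞^σ` for some `σ > κ`. -/
def MemAinftyWeak [MeasurableSpace X] (ρ : X → X → ℝ) (μ : Measure X) (κ : ℝ)
    (w : X → ℝ≥0∞) : Prop :=
  ∃ σ : ℝ, κ < σ ∧ MemAinfty ρ μ σ w

/-- The `σ`-weak `q`-Reverse Hölder inequality with constant `C`:
`(⨍_B w^q dμ)^{1/q} ≤ C ⋅ ⨍_{σB} w dμ` for all balls `B`. -/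
def RHIneq [MeasurableSpace X] (ρ : X → X → ℝ) (μ : Measure X) (q σ : ℝ)
    (w : X → ℝ≥0∞) (C : ℝ≥0∞) : Prop :=
  ∀ (x : X) (r : ℝ), 0 < r →
    (avg μ (qball ρ x r) (fun y => w y ^ q)) ^ (1 / q)
      ≤ C * avg μ (qball ρ x (σ * r)) w

/-- Membership in the `σ`-weak `q`-Reverse Hölder class `RH_q^σ`. -/
def MemRH [MeasurableSpace X] (ρ : X → X → ℝ) (μ : Measure X) (q σ : ℝ)
    (w : X → ℝ≥0∞) : Prop :=
  ∃ C : ℝ≥0∞, C ≠ ⊤ ∧ RHIneq ρ μ q σ w C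

/-- The constant `[w]_{RH_q}^σ`: the least admissible constant. -/
noncomputable def rhConst [MeasurableSpace X] (ρ : X → X → ℝ) (μ : Measure X) (q σ : ℝ)
    (w : X → ℝ≥0∞) : ℝ≥0∞ :=
  sInf {C : ℝ≥0∞ | RHIneq ρ μ q σ w C}

/-- Membership in the weak `q`-Reverse Hölder class: `w ∈ RH_q^σ` for some `σ > κ`. -/
def MemRHWeak [MeasurableSpace X] (ρ : X → X → ℝ) (μ : Measure X) (κ q : ℝ)
    (w : X → ℝ≥0∞) : Prop :=
  ∃ σ : ℝ, κ < σ ∧ MemRH ρ μ q σ w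

theorem qball_mono (ρ : X → X → ℝ) (x : X) {r s : ℝ} (h : r ≤ s) :
    qball ρ x r ⊆ qball ρ x s := fun _ hy => lt_of_lt_of_le hy h

namespace IsSHT

variable [MeasurableSpace X] {ρ : X → X → ℝ} {μ : Measure X} {κ D : ℝ}

theorem kappa_pos (hX : IsSHT ρ μ κ D) : 0 < κ := one_pos.trans_le hX.one_le_kappa

theorem measure_qball_two_pow_mul_le (hX : IsSHT ρ μ κ D) (x : X) (r : ℝ) (n : ℕ) :
    μ (qball ρ x (2 ^ n * r)) ≤ ENNReal.ofReal D ^ n * μ (qball ρ x r) := by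
  induction n with
  | zero => simp
  | succ n ih =>
    calc μ (qball ρ x (2 ^ (n + 1) * r)) = μ (qball ρ x (2 * (2 ^ n * r))) := by
          congr 2; ring
      _ ≤ ENNReal.ofReal D * μ (qball ρ x (2 ^ n * r)) := hX.doubling _ _
      _ ≤ ENNReal.ofReal D * (ENNReal.ofReal D ^ n * μ (qball ρ x r)) := by gcongr
      _ = ENNReal.ofReal D ^ (n + 1) * μ (qball ρ x r) := by ring

/-- The measure of a dilated ball is uniformly comparable to that of the ball. -/
theorem exists_measure_qball_mul_le (hX : IsSHT ρ μ κ D) (a : ℝ) :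
    ∃ C : ℝ≥0∞, C ≠ ⊤ ∧ ∀ (x : X) (r : ℝ), 0 < r →
      μ (qball ρ x (a * r)) ≤ C * μ (qball ρ x r) := by
  obtain ⟨n, hn⟩ := pow_unbounded_of_one_lt a one_lt_two
  refine ⟨ENNReal.ofReal D ^ n, ENNReal.pow_ne_top ENNReal.ofReal_ne_top, fun x r hr => ?_⟩
  refine (measure_mono (qball_mono ρ x ?_)).trans (hX.measure_qball_two_pow_mul_le x r n)
  gcongr

/-- A set of `ε r`-separated points in a ball of radius `r` has uniformly bounded cardinality. -/
theorem exists_card_le_of_separated (hX : IsSHT ρ μ κ D) {ε : ℝ} (hε : 0 < ε) :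
    ∃ N : ℕ, ∀ (x : X) (r : ℝ), 0 < r → ∀ S : Finset X, (∀ p ∈ S, p ∈ qball ρ x r) →
      (∀ p ∈ S, ∀ q ∈ S, p ≠ q → ε * r ≤ ρ p q) → S.card ≤ N := by
  have hκ := hX.kappa_pos
  set δ : ℝ := ε / (2 * κ) with hδ
  have hδ0 : 0 < δ := by positivity
  set K : ℝ := κ * (1 + δ) with hK
  obtain ⟨C, hC, hCb⟩ := hX.exists_measure_qball_mul_le (κ * (1 + K) / δ)
  obtain ⟨N, hN⟩ := ENNReal.exists_nat_gt hC
  refine ⟨N, fun x r hr S hSB hS => ?_⟩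
  have hpos : μ (qball ρ x (K * r)) ≠ 0 := (hX.ball_pos x _ (by positivity)).ne'
  have hfin : μ (qball ρ x (K * r)) ≠ ⊤ := (hX.ball_lt_top x _).ne
  have hcomp : ∀ p ∈ S, μ (qball ρ x (K * r)) ≤ C * μ (qball ρ p (δ * r)) := by
    intro p hp
    refine (measure_mono fun y hy => ?_).trans (hCb p (δ * r) (by positivity))
    have h1 : ρ x p < r := hSB p hp
    have h2 : ρ x y < K * r := hy
    have h3 := hX.quasi_triangle p y x
    rw [hX.symm p x] at h3
    have h4 : κ * (1 + K) / δ * (δ * r) = κ * (r + K * r) := by field_simp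
    change ρ p y < _
    rw [h4]
    refine h3.trans_lt ?_
    gcongr
  have hdisj : Set.PairwiseDisjoint (↑S : Set X) fun p => qball ρ p (δ * r) := by
    intro p hp q hq hpq
    refine Set.disjoint_left.2 fun y hyp hyq => ?_
    have h1 : ρ p y < δ * r := hyp
    have h2 : ρ q y < δ * r := hyq
    have h3 := hX.quasi_triangle p q y
    rw [hX.symm y q] at h3
    have h4 : ε * r = κ * (δ * r + δ * r) := by rw [hδ]; field_simp; norm_num
    have h5 : κ * (ρ p y + ρ q y) < κ * (δ * r + δ * r) := by gcongr
    linarith [hS p hp q hq hpq]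
  have hsub : (⋃ p ∈ S, qball ρ p (δ * r)) ⊆ qball ρ x (K * r) := by
    refine Set.iUnion₂_subset fun p hp y hy => ?_
    have h1 : ρ x p < r := hSB p hp
    have h2 : ρ p y < δ * r := hy
    have h4 : K * r = κ * (r + δ * r) := by rw [hK]; ring
    change ρ x y < _
    rw [h4]
    refine (hX.quasi_triangle x y p).trans_lt ?_
    gcongr
  have hle : (S.card : ℝ≥0∞) * μ (qball ρ x (K * r)) ≤ C * μ (qball ρ x (K * r)) :=
    calc (S.card : ℝ≥0∞) * μ (qball ρ x (K * r))
        = ∑ _p ∈ S, μ (qball ρ x (K * r)) := by simp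
      _ ≤ ∑ p ∈ S, C * μ (qball ρ p (δ * r)) := Finset.sum_le_sum hcomp
      _ = C * μ (⋃ p ∈ S, qball ρ p (δ * r)) := by
          rw [measure_biUnion_finset hdisj fun p _ => hX.ball_measurable p _, Finset.mul_sum]
      _ ≤ C * μ (qball ρ x (K * r)) := by gcongr
  have := ((ENNReal.mul_le_mul_iff_left hpos hfin).1 hle).trans hN.le
  exact_mod_cast this

/-- A ball of radius `r` is covered by a uniformly bounded number of balls of radius `ε r`
centered in it. -/
theorem exists_cover (hX : IsSHT ρ μ κ D) {ε : ℝ} (hε : 0 < ε) :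
    ∃ N : ℕ, ∀ (x : X) (r : ℝ), 0 < r → ∃ S : Finset X, S.card ≤ N ∧
      (∀ p ∈ S, p ∈ qball ρ x r) ∧ qball ρ x r ⊆ ⋃ p ∈ S, qball ρ p (ε * r) := by
  classical
  obtain ⟨N, hN⟩ := hX.exists_card_le_of_separated hε
  refine ⟨N, fun x r hr => ?_⟩
  by_contra! hcon
  have key : ∀ n : ℕ, ∃ S : Finset X, S.card = n ∧ (∀ p ∈ S, p ∈ qball ρ x r) ∧
      ∀ p ∈ S, ∀ q ∈ S, p ≠ q → ε * r ≤ ρ p q := by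
    intro n
    induction n with
    | zero => exact ⟨∅, by simp⟩
    | succ n ih =>
      obtain ⟨S, hc, hSB, hS⟩ := ih
      obtain ⟨y, hy, hyS⟩ := Set.not_subset.1 (hcon S (hN x r hr S hSB hS) hSB)
      have hfar : ∀ p ∈ S, ε * r ≤ ρ p y := by
        intro p hp
        by_contra! h
        exact hyS (Set.mem_biUnion hp h)
      have hyn : y ∉ S := by
        intro h
        have h1 := hfar y h
        rw [(hX.eq_zero_iff y y).2 rfl] at h1
        exact absurd h1 (not_le.2 (by positivity))
      refine ⟨insert y S, by rw [Finset.card_insert_of_notMem hyn, hc], ?_, ?_⟩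
      · intro p hp
        rcases Finset.mem_insert.1 hp with rfl | hp
        exacts [hy, hSB p hp]
      · intro p hp q hq hpq
        rcases Finset.mem_insert.1 hp with rfl | hpS <;>
          rcases Finset.mem_insert.1 hq with rfl | hqS
        · exact absurd rfl hpq
        · rw [hX.symm]; exact hfar q hqS
        · exact hfar p hpS
        · exact hS p hpS q hqS hpq
  obtain ⟨S, hc, hSB, hS⟩ := key (N + 1)
  have := hN x r hr S hSB hS
  omega

/-- For points of `B(x,r) ∩ B(p, ε r)`, the maximal function of `1_{B(x,r)} w` is controlled by
the average of `w` on `B(x,r)` and by the maximal function of `w` localized near `p`. -/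
theorem exists_maximal_indicator_le (hX : IsSHT ρ μ κ D) {ε : ℝ} (hε : 0 < ε) :
    ∃ C : ℝ≥0∞, C ≠ ⊤ ∧ ∀ (w : X → ℝ≥0∞) (x p y : X) (r : ℝ), 0 < r →
      y ∈ qball ρ x r → y ∈ qball ρ p (ε * r) →
      maximal ρ μ ((qball ρ x r).indicator w) y ≤
        C * avg μ (qball ρ x r) w +
          maximal ρ μ ((qball ρ p (κ * (1 + 2 * κ) * ε * r)).indicator w) y := by
  have hκ := hX.kappa_pos
  obtain ⟨C, hC, hCb⟩ := hX.exists_measure_qball_mul_le (κ * (1 + 2 * κ / ε))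
  refine ⟨C, hC, fun w x p y r hr hy hyp => ?_⟩
  refine iSup_le fun z => iSup_le fun s => iSup_le fun hs => iSup_le fun hyz => ?_
  have hyz' : ρ z y < s := hyz
  rcases le_or_gt (ε * r) s with hlarge | hsmall
  · refine le_trans ?_ le_self_add
    have hμ : μ (qball ρ x r) ≤ C * μ (qball ρ z s) := by
      refine (measure_mono fun u hu => ?_).trans (hCb z s hs)
      have h1 : ρ x u < r := hu
      have h2 : ρ x y < r := hy
      have h3 := hX.quasi_triangle y u x
      rw [hX.symm y x] at h3
      have h4 : ρ y u < κ * (r + r) := h3.trans_lt (by gcongr)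
      have h5 : r ≤ s / ε := by rw [le_div_iff₀ hε]; linarith
      change ρ z u < _
      calc ρ z u ≤ κ * (ρ z y + ρ y u) := hX.quasi_triangle z u y
        _ < κ * (s + κ * (r + r)) := by gcongr
        _ ≤ κ * (s + κ * (s / ε + s / ε)) := by gcongr
        _ = κ * (1 + 2 * κ / ε) * s := by ring
    have hinv : (μ (qball ρ z s))⁻¹ ≤ C * (μ (qball ρ x r))⁻¹ := by
      rw [← div_eq_mul_inv, ENNReal.le_div_iff_mul_le (Or.inl (hX.ball_pos x r hr).ne')
        (Or.inl (hX.ball_lt_top x r).ne), mul_comm, ← div_eq_mul_inv]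
      exact ENNReal.div_le_of_le_mul hμ
    calc (μ (qball ρ z s))⁻¹ * ∫⁻ u in qball ρ z s, (qball ρ x r).indicator w u ∂μ
        ≤ C * (μ (qball ρ x r))⁻¹ * ∫⁻ u, (qball ρ x r).indicator w u ∂μ :=
          mul_le_mul' hinv (setLIntegral_le_lintegral _ _)
      _ = C * avg μ (qball ρ x r) w := by
          rw [lintegral_indicator (hX.ball_measurable x r), avg, mul_assoc]
  · refine le_trans ?_ le_add_self
    have hsub : qball ρ z s ⊆ qball ρ p (κ * (1 + 2 * κ) * ε * r) := by
      intro u hu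
      have h1 : ρ z u < s := hu
      have h2 : ρ p y < ε * r := hyp
      have h3 := hX.quasi_triangle y u z
      rw [hX.symm y z] at h3
      have h4 : ρ y u < κ * (ε * r + ε * r) := h3.trans_lt (by gcongr <;> linarith)
      change ρ p u < _
      calc ρ p u ≤ κ * (ρ p y + ρ y u) := hX.quasi_triangle p u y
        _ < κ * (ε * r + κ * (ε * r + ε * r)) := by gcongr
        _ = κ * (1 + 2 * κ) * ε * r := by ring
    refine le_trans ?_ (le_iSup_of_le z <| le_iSup_of_le s <| le_iSup_of_le hs <|
      le_iSup_of_le hyz le_rfl)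
    refine mul_le_mul' le_rfl (setLIntegral_mono' (hX.ball_measurable z s) fun u hu => ?_)
    rw [Set.indicator_of_mem (hsub hu)]
    exact Set.indicator_le_self _ _ u

end IsSHT

theorem MemAinfty.of_kappa_lt [MeasurableSpace X] {ρ : X → X → ℝ} {μ : Measure X} {κ D : ℝ}
    (hX : IsSHT ρ μ κ D) {σ σ' : ℝ} (hσ : κ < σ) (hσ' : κ < σ') {w : X → ℝ≥0∞}
    (hw : MemAinfty ρ μ σ' w) : MemAinfty ρ μ σ w := by
  have hκ := hX.kappa_pos
  have hκ1 := hX.one_le_kappa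
  have hσ'0 : 0 < σ' := hκ.trans hσ'
  obtain ⟨A, hA, hAw⟩ := hw
  set ε : ℝ := (σ - κ) / (κ * σ' * (κ * (1 + 2 * κ))) with hεdef
  have hε : 0 < ε := div_pos (sub_pos.2 hσ) (by positivity)
  obtain ⟨N, hN⟩ := hX.exists_cover hε
  obtain ⟨C, hC, hmax⟩ := hX.exists_maximal_indicator_le hε
  refine ⟨N * (C + A), ENNReal.mul_ne_top (by simp) (ENNReal.add_ne_top.2 ⟨hC, hA⟩),
    fun x r hr => ?_⟩
  obtain ⟨S, hcard, hSB, hcov⟩ := hN x r hr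
  set B := qball ρ x r
  set W := ∫⁻ y in qball ρ x (σ * r), w y ∂μ
  have hBW : ∫⁻ y in B, w y ∂μ ≤ W := lintegral_mono_set (qball_mono ρ x (by nlinarith))
  have hpiece : ∀ p ∈ S, ∫⁻ y in B ∩ qball ρ p (ε * r), maximal ρ μ (B.indicator w) y ∂μ
      ≤ (C + A) * W := by
    intro p hp
    set R : ℝ := κ * (1 + 2 * κ) * ε * r with hR
    have hR0 : 0 < R := by positivity
    have hεR : ε * r ≤ R := by
      have h1 : 1 ≤ κ * (1 + 2 * κ) := by nlinarith
      have h2 : 0 < ε * r := by positivity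
      rw [hR]; nlinarith
    have hsub : qball ρ p (σ' * R) ⊆ qball ρ x (σ * r) := by
      intro u hu
      have h1 : ρ p u < σ' * R := hu
      have h2 : ρ x p < r := hSB p hp
      change ρ x u < _
      calc ρ x u ≤ κ * (ρ x p + ρ p u) := hX.quasi_triangle x u p
        _ < κ * (r + σ' * R) := by gcongr
        _ = σ * r := by rw [hR, hεdef]; field_simp; ring
    have hmB : MeasurableSet (B ∩ qball ρ p (ε * r)) :=
      (hX.ball_measurable x r).inter (hX.ball_measurable p _)
    calc ∫⁻ y in B ∩ qball ρ p (ε * r), maximal ρ μ (B.indicator w) y ∂μ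
        ≤ ∫⁻ y in B ∩ qball ρ p (ε * r),
            (C * avg μ B w + maximal ρ μ ((qball ρ p R).indicator w) y) ∂μ :=
          setLIntegral_mono' hmB fun y hy => hmax w x p y r hr hy.1 hy.2
      _ = C * avg μ B w * μ (B ∩ qball ρ p (ε * r)) +
            ∫⁻ y in B ∩ qball ρ p (ε * r), maximal ρ μ ((qball ρ p R).indicator w) y ∂μ := by
          rw [lintegral_add_left measurable_const, setLIntegral_const]
      _ ≤ C * avg μ B w * μ B +
            ∫⁻ y in qball ρ p R, maximal ρ μ ((qball ρ p R).indicator w) y ∂μ := by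
          refine add_le_add (by gcongr; exact Set.inter_subset_left) (lintegral_mono_set ?_)
          exact Set.inter_subset_right.trans (qball_mono ρ p hεR)
      _ ≤ C * W + A * W := by
          refine add_le_add ?_ ((hAw p R hR0).trans ?_)
          · have h1 : avg μ B w * μ B = ∫⁻ y in B, w y ∂μ := by
              rw [avg, mul_comm, ← mul_assoc, ENNReal.mul_inv_cancel (hX.ball_pos x r hr).ne'
                (hX.ball_lt_top x r).ne, one_mul]
            rw [mul_assoc, h1]
            gcongr
          · gcongr
            exact lintegral_mono_set hsub
      _ = (C + A) * W := by ring
  calc ∫⁻ y in B, maximal ρ μ (B.indicator w) y ∂μ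
      ≤ ∫⁻ y in ⋃ p ∈ S, B ∩ qball ρ p (ε * r), maximal ρ μ (B.indicator w) y ∂μ := by
        refine lintegral_mono_set fun y hy => ?_
        obtain ⟨p, hp, hyp⟩ := Set.mem_iUnion₂.1 (hcov hy)
        exact Set.mem_biUnion hp ⟨hy, hyp⟩
    _ ≤ ∑ p ∈ S, ∫⁻ y in B ∩ qball ρ p (ε * r), maximal ρ μ (B.indicator w) y ∂μ := by
        rw [← S.sum_coe_sort, ← Finset.set_biUnion_coe, Set.biUnion_eq_iUnion]
        exact (lintegral_iUnion_le _ _).trans_eq (tsum_fintype _)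
    _ ≤ ∑ _p ∈ S, (C + A) * W := Finset.sum_le_sum hpiece
    _ = S.card * ((C + A) * W) := by simp
    _ ≤ N * ((C + A) * W) := by gcongr
    _ = N * (C + A) * W := by ring

/-- The classes `A_∞^σ` coincide for all `σ > κ`. -/
theorem memAinfty_congr [MeasurableSpace X] (ρ : X → X → ℝ) (μ : Measure X)
    (κ D : ℝ) (hX : IsSHT ρ μ κ D) :
    ∀ σ σ' : ℝ, κ < σ → κ < σ' → ∀ w : X → ℝ≥0∞, IsWeight ρ μ w →
      (MemAinfty ρ μ σ w ↔ MemAinfty ρ μ σ' w) := by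
  exact fun σ σ' hσ hσ' w _ =>
    ⟨MemAinfty.of_kappa_lt hX hσ' hσ, MemAinfty.of_kappa_lt hX hσ hσ'⟩

end SHT
end

section
/- Let (X,ρ,μ) be a space of homogeneous type with quasi-triangle constant κ and doubling constant D, and let N < ∞ be a constant such that every ball of radius r can be covered by at most N balls of radius r/2 (such N exists depending only on D and κ). Then for every σ > 1, for μ-almost every x ∈ X the following holds: for every ε > 0 there exists r ∈ (0,ε) such that μ(B(x,σr)) ≤ 2·σ^{log₂ N}·μ(B(x,r)). -/
open MeasureTheory ENNReal

namespace SHT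

variable {X : Type*}

/-- Iterating the halving property `m` times, a ball of radius `r` is covered by at most `N ^ m`
balls of radius `r / 2 ^ m`. -/
theorem exists_cover_qball_div_two_pow {ρ : X → X → ℝ} {N : ℕ}
    (hN : ∀ (x : X) (r : ℝ), 0 < r → ∃ s : Finset X, s.card ≤ N ∧
      qball ρ x r ⊆ ⋃ y ∈ s, qball ρ y (r / 2))
    (x : X) {r : ℝ} (hr : 0 < r) (m : ℕ) :
    ∃ s : Finset X, s.card ≤ N ^ m ∧ qball ρ x r ⊆ ⋃ y ∈ s, qball ρ y (r / 2 ^ m) := by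
  classical
  induction m with
  | zero => exact ⟨{x}, by simp, by simp⟩
  | succ m ih =>
    obtain ⟨s, hs, hcov⟩ := ih
    choose t ht htcov using fun y => hN y (r / 2 ^ m) (by positivity)
    refine ⟨s.biUnion t, ?_, fun z hz => ?_⟩
    · calc (s.biUnion t).card ≤ s.card * N := Finset.card_biUnion_le_card_mul _ _ _ fun y _ => ht y
        _ ≤ N ^ m * N := Nat.mul_le_mul_right _ hs
        _ = N ^ (m + 1) := (pow_succ _ _).symm
    · obtain ⟨y, hy, hzy⟩ := Set.mem_iUnion₂.1 (hcov hz)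
      obtain ⟨w, hw, hzw⟩ := Set.mem_iUnion₂.1 (htcov y hzy)
      refine Set.mem_iUnion₂.2 ⟨w, Finset.mem_biUnion.2 ⟨y, hy, hw⟩, ?_⟩
      rwa [div_div, ← pow_succ] at hzw

/-- If every ball around `x` of radius less than `ε` has measure growing by a factor at least `A`
under dilation by `σ`, then small balls around `x` decay geometrically. -/
theorem pow_mul_measure_qball_le [MeasurableSpace X] {ρ : X → X → ℝ} {μ : Measure X} {σ ε : ℝ}
    {A : ℝ≥0∞} {x : X} (hσ : 1 < σ) (hε : 0 < ε)
    (h : ∀ r, 0 < r → r < ε → A * μ (qball ρ x r) ≤ μ (qball ρ x (σ * r))) (k : ℕ) :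
    A ^ k * μ (qball ρ x (ε / σ ^ k)) ≤ μ (qball ρ x ε) := by
  have hσ0 : 0 < σ := one_pos.trans hσ
  induction k with
  | zero => simp
  | succ k ih =>
    refine le_trans ?_ ih
    rw [pow_succ, mul_assoc]
    gcongr
    have := h (ε / σ ^ (k + 1)) (by positivity)
      (div_lt_self hε (one_lt_pow₀ hσ k.succ_ne_zero))
    rwa [show σ * (ε / σ ^ (k + 1)) = ε / σ ^ k by rw [pow_succ]; field_simp] at this

theorem IsSHT.qball_subset_qball [MeasurableSpace X] {ρ : X → X → ℝ} {μ : Measure X} {κ D : ℝ}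
    (hX : IsSHT ρ μ κ D) {x y : X} {r s t : ℝ} (hy : y ∈ qball ρ x r)
    (ht : κ * (r + s) ≤ t) : qball ρ y s ⊆ qball ρ x t := by
  intro z hz
  have hy' : ρ x y < r := hy
  have hz' : ρ y z < s := hz
  have hκ : 0 < κ := one_pos.trans_le hX.one_le_kappa
  calc ρ x z ≤ κ * (ρ x y + ρ y z) := hX.quasi_triangle x z y
    _ < κ * (r + s) := by gcongr
    _ ≤ t := ht

theorem IsSHT.mem_qball_symm [MeasurableSpace X] {ρ : X → X → ℝ} {μ : Measure X} {κ D : ℝ}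
    (hX : IsSHT ρ μ κ D) {x y : X} {r : ℝ} (h : y ∈ qball ρ x r) : x ∈ qball ρ y r := by
  change ρ y x < r
  rw [hX.symm]
  exact h

/-- A bounded set of points at which every ball of radius less than `ε` fails the growth bound
is null. -/
theorem IsSHT.measure_eq_zero_of_growth [MeasurableSpace X] {ρ : X → X → ℝ} {μ : Measure X}
    {κ D : ℝ} (hX : IsSHT ρ μ κ D) {N : ℕ}
    (hN : ∀ (x : X) (r : ℝ), 0 < r → ∃ s : Finset X, s.card ≤ N ∧
      qball ρ x r ⊆ ⋃ y ∈ s, qball ρ y (r / 2))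
    {σ ε R : ℝ} (hσ : 1 < σ) (hε : 0 < ε) (hR : ε ≤ R) {E : Set X} {x₀ : X}
    (hE : E ⊆ qball ρ x₀ R)
    (hgrowth : ∀ x ∈ E, ∀ r, 0 < r → r < ε →
      ENNReal.ofReal (2 * σ ^ Real.logb 2 N) * μ (qball ρ x r) ≤ μ (qball ρ x (σ * r))) :
    μ E = 0 := by
  have hσ0 : 0 < σ := one_pos.trans hσ
  have hκ : 1 ≤ κ := hX.one_le_kappa
  have hκ0 : 0 < κ := one_pos.trans_le hκ
  have hR0 : 0 < R := hε.trans_le hR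
  have hN1 : 1 ≤ N := by
    obtain ⟨s, hs, hcov⟩ := hN x₀ 1 one_pos
    have hx₀ : x₀ ∈ qball ρ x₀ 1 := by
      change ρ x₀ x₀ < 1
      rw [(hX.eq_zero_iff x₀ x₀).2 rfl]
      exact one_pos
    obtain ⟨y, hy, -⟩ := Set.mem_iUnion₂.1 (hcov hx₀)
    exact (Finset.card_pos.2 ⟨y, hy⟩).trans_le hs
  set L := Real.logb 2 N with hL
  have hL0 : 0 ≤ L := Real.logb_nonneg one_lt_two (by exact_mod_cast hN1)
  have hNL : (2 : ℝ) ^ L = N :=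
    Real.rpow_logb two_pos (by norm_num) (by exact_mod_cast hN1)
  set S := σ ^ L with hS
  have hS0 : 0 < S := Real.rpow_pos_of_pos hσ0 L
  set M := μ (qball ρ x₀ (κ * (R + ε))) with hM
  have hMtop : M ≠ ⊤ := (hX.ball_lt_top _ _).ne
  have hEtop : μ E ≠ ⊤ := ((measure_mono hE).trans_lt (hX.ball_lt_top _ _)).ne
  have hcover : ∀ k m : ℕ, 2 * κ * R * σ ^ k / ε ≤ 2 ^ m →
      ENNReal.ofReal (2 * S) ^ k * μ E ≤ (N : ℝ≥0∞) ^ m * M := by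
    intro k m hkm
    obtain ⟨s, hs, hcov⟩ := exists_cover_qball_div_two_pow hN x₀ hR0 m
    have hpiece : ∀ y ∈ s,
        ENNReal.ofReal (2 * S) ^ k * μ (E ∩ qball ρ y (R / 2 ^ m)) ≤ M := by
      intro y _
      rcases (E ∩ qball ρ y (R / 2 ^ m)).eq_empty_or_nonempty with h | ⟨x, hxE, hxy⟩
      · simp [h]
      have hrad : κ * (R / 2 ^ m + R / 2 ^ m) ≤ ε / σ ^ k := by
        rw [div_le_iff₀ hε] at hkm
        rw [show κ * (R / 2 ^ m + R / 2 ^ m) = 2 * κ * R / 2 ^ m by ring,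
          div_le_div_iff₀ (by positivity) (by positivity)]
        linarith
      calc ENNReal.ofReal (2 * S) ^ k * μ (E ∩ qball ρ y (R / 2 ^ m))
          ≤ ENNReal.ofReal (2 * S) ^ k * μ (qball ρ x (ε / σ ^ k)) := by
            gcongr
            exact Set.inter_subset_right.trans
              (hX.qball_subset_qball (hX.mem_qball_symm hxy) hrad)
        _ ≤ μ (qball ρ x ε) := pow_mul_measure_qball_le hσ hε (hgrowth x hxE) k
        _ ≤ M := measure_mono (hX.qball_subset_qball (hE hxE) le_rfl)
    have hEcov : E ⊆ ⋃ y ∈ s, E ∩ qball ρ y (R / 2 ^ m) := by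
      rw [← Set.inter_iUnion₂]
      exact Set.subset_inter subset_rfl (hE.trans hcov)
    calc ENNReal.ofReal (2 * S) ^ k * μ E
        ≤ ENNReal.ofReal (2 * S) ^ k * ∑ y ∈ s, μ (E ∩ qball ρ y (R / 2 ^ m)) := by
          gcongr
          exact (measure_mono hEcov).trans (measure_biUnion_finset_le _ _)
      _ = ∑ y ∈ s, ENNReal.ofReal (2 * S) ^ k * μ (E ∩ qball ρ y (R / 2 ^ m)) :=
          Finset.mul_sum _ _ _
      _ ≤ s.card • M := Finset.sum_le_card_nsmul _ _ _ hpiece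
      _ = (s.card : ℝ≥0∞) * M := nsmul_eq_mul _ _
      _ ≤ (N : ℝ≥0∞) ^ m * M := by
          gcongr
          exact_mod_cast hs
  have hreal : ∀ k : ℕ, 2 ^ k * (μ E).toReal ≤ (4 * κ * R / ε) ^ L * M.toReal := by
    intro k
    have hone : 1 ≤ 2 * κ * R * σ ^ k / ε := by
      rw [le_div_iff₀ hε]
      have h1 : 1 ≤ κ * σ ^ k := one_le_mul_of_one_le_of_one_le hκ (one_le_pow₀ hσ.le)
      nlinarith
    obtain ⟨n, hn, hn'⟩ := exists_nat_pow_near hone one_lt_two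
    have hle := ENNReal.toReal_mono (by finiteness) (hcover k (n + 1) hn'.le)
    rw [ENNReal.toReal_mul, ENNReal.toReal_mul, ENNReal.toReal_pow, ENNReal.toReal_pow,
      ENNReal.toReal_ofReal (by positivity), ENNReal.toReal_natCast] at hle
    have hNpow : (N : ℝ) ^ (n + 1) ≤ (4 * κ * R / ε) ^ L * S ^ k := by
      calc (N : ℝ) ^ (n + 1) = ((2 : ℝ) ^ (n + 1)) ^ L := by
            rw [← hNL, Real.rpow_pow_comm zero_le_two]
        _ ≤ (4 * κ * R / ε * σ ^ k) ^ L := by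
            refine Real.rpow_le_rpow (by positivity) ?_ hL0
            calc (2 : ℝ) ^ (n + 1) = 2 * 2 ^ n := pow_succ' _ _
              _ ≤ 2 * (2 * κ * R * σ ^ k / ε) := by gcongr
              _ = 4 * κ * R / ε * σ ^ k := by ring
        _ = (4 * κ * R / ε) ^ L * S ^ k := by
            rw [Real.mul_rpow (by positivity) (by positivity), hS,
              Real.rpow_pow_comm hσ0.le]
    refine le_of_mul_le_mul_right ?_ (pow_pos hS0 k)
    calc 2 ^ k * (μ E).toReal * S ^ k = (2 * S) ^ k * (μ E).toReal := by rw [mul_pow]; ring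
      _ ≤ (N : ℝ) ^ (n + 1) * M.toReal := hle
      _ ≤ (4 * κ * R / ε) ^ L * S ^ k * M.toReal := by gcongr
      _ = (4 * κ * R / ε) ^ L * M.toReal * S ^ k := by ring
  by_contra hne
  have hpos : 0 < (μ E).toReal := ENNReal.toReal_pos hne hEtop
  obtain ⟨k, hk⟩ := pow_unbounded_of_one_lt
    ((4 * κ * R / ε) ^ L * M.toReal / (μ E).toReal) one_lt_two
  rw [div_lt_iff₀ hpos] at hk
  exact (hreal k).not_gt hk

/-- Small doubling balls exist at a.e. point and at arbitrarily small scales: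
if every ball of radius `r` is covered by at most `N` balls of radius `r/2`, then for
`σ > 1` and μ-a.e. `x`, for every `ε > 0` there is `r ∈ (0,ε)` with
`μ(B(x,σr)) ≤ 2·σ^{log₂ N}·μ(B(x,r))`. -/
theorem ae_exists_doubling_ball [MeasurableSpace X] (ρ : X → X → ℝ) (μ : Measure X)
    (κ D : ℝ) (hX : IsSHT ρ μ κ D) (N : ℕ)
    (hN : ∀ (x : X) (r : ℝ), 0 < r → ∃ s : Finset X, s.card ≤ N ∧
      qball ρ x r ⊆ ⋃ y ∈ s, qball ρ y (r / 2)) :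
    ∀ σ : ℝ, 1 < σ →
      ∀ᵐ x ∂μ, ∀ ε : ℝ, 0 < ε → ∃ r : ℝ, 0 < r ∧ r < ε ∧
        μ (qball ρ x (σ * r))
          ≤ ENNReal.ofReal (2 * σ ^ (Real.logb 2 N)) * μ (qball ρ x r) := by
  intro σ hσ
  rcases isEmpty_or_nonempty X with hempty | ⟨⟨x₀⟩⟩
  · exact Filter.Eventually.of_forall fun x => isEmptyElim x
  let E : ℕ → Set X := fun n => {x | x ∈ qball ρ x₀ (n + 1) ∧
    ∀ r, 0 < r → r < 1 / ((n : ℝ) + 1) →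
      ENNReal.ofReal (2 * σ ^ Real.logb 2 N) * μ (qball ρ x r) ≤ μ (qball ρ x (σ * r))}
  have hE : ∀ n, μ (E n) = 0 := fun n =>
    hX.measure_eq_zero_of_growth hN hσ (ε := 1 / ((n : ℝ) + 1)) (R := n + 1) (by positivity)
      ((div_le_one (by positivity)).2 (by simp) |>.trans (by simp)) (fun x hx => hx.1)
      fun x hx => hx.2
  refine measure_mono_null (fun x hx => ?_) (measure_iUnion_null hE)
  simp only [Set.mem_compl_iff, Set.mem_ofPred_eq, not_forall, not_exists, not_and, not_le] at hx
  obtain ⟨ε, hε, hbad⟩ := hx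
  obtain ⟨n₁, hn₁⟩ := exists_nat_one_div_lt hε
  obtain ⟨n₂, hn₂⟩ := exists_nat_gt (ρ x₀ x)
  refine Set.mem_iUnion.2 ⟨max n₁ n₂, ?_, fun r hr hrn => (hbad r hr (hrn.trans ?_)).le⟩
  · change ρ x₀ x < _
    have : (n₂ : ℝ) ≤ (max n₁ n₂ : ℕ) := by exact_mod_cast le_max_right _ _
    linarith
  · refine lt_of_le_of_lt ?_ hn₁
    have : (n₁ : ℝ) ≤ (max n₁ n₂ : ℕ) := by exact_mod_cast le_max_left _ _
    gcongr

end SHT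
end

section
/- On the real line with the Euclidean metric and Lebesgue measure, the weight w(x) = e^x satisfies: (a) for every σ > 1 and every bounded open interval I, ∫_I M(1_I w) dx ≤ (2/(σ−1))·∫_{σI} w dx, where σI is the interval with the same center as I and σ times its length; in particular w ∈ A_∞^σ for every σ > 1; (b) the measure w dx is not doubling: for every k ∈ ℕ, with I_k := (k,3k), one has w(2I_k)/w(I_k) ≥ e^k, so sup_I w(2I)/w(I) = ∞ over bounded intervals I. -/
open MeasureTheory ENNReal

namespace ExpWeight

/-- The non-centered Hardy-Littlewood maximal operator on `ℝ` (w.r.t. Lebesgue measure),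
with the supremum over bounded open intervals containing the point. -/
noncomputable def mOp (f : ℝ → ℝ≥0∞) (x : ℝ) : ℝ≥0∞ :=
  ⨆ (a : ℝ) (b : ℝ) (_ : a < b) (_ : x ∈ Set.Ioo a b),
    (volume (Set.Ioo a b))⁻¹ * ∫⁻ y in Set.Ioo a b, f y

/-- The `σ`-dilation of the interval `(a,b)`: the interval with the same center and
`σ` times the length. -/
def dil (σ a b : ℝ) : Set ℝ :=
  Set.Ioo ((a + b) / 2 - σ * (b - a) / 2) ((a + b) / 2 + σ * (b - a) / 2)

/-- The weight `w(x) = e^x` (as an `ℝ≥0∞`-valued function). -/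
noncomputable def wexp : ℝ → ℝ≥0∞ := fun x => ENNReal.ofReal (Real.exp x)

theorem mOp_le_of_le {f : ℝ → ℝ≥0∞} {M : ℝ≥0∞} (h : ∀ y, f y ≤ M) (x : ℝ) : mOp f x ≤ M := by
  refine iSup₂_le fun c d => iSup₂_le fun hcd _ => ?_
  have hpos : volume (Set.Ioo c d) ≠ 0 := by simpa using hcd
  have hfin : volume (Set.Ioo c d) ≠ ⊤ := by simp
  calc (volume (Set.Ioo c d))⁻¹ * ∫⁻ y in Set.Ioo c d, f y
      ≤ (volume (Set.Ioo c d))⁻¹ * ∫⁻ _ in Set.Ioo c d, M := by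
        gcongr with y
        exact h y
    _ = M := by
        rw [setLIntegral_const, mul_comm M, ← mul_assoc, ENNReal.inv_mul_cancel hpos hfin, one_mul]

theorem lintegral_wexp_Ioo {a b : ℝ} (hab : a ≤ b) :
    ∫⁻ x in Set.Ioo a b, wexp x = ENNReal.ofReal (Real.exp b - Real.exp a) := by
  rw [← integral_exp, intervalIntegral.integral_of_le hab, ← restrict_Ioo_eq_restrict_Ioc]
  exact (ofReal_integral_eq_lintegral_ofReal
    (Real.continuous_exp.integrableOn_Icc.mono_set Set.Ioo_subset_Icc_self)
    (Filter.Eventually.of_forall fun x => (Real.exp_pos x).le)).symm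

theorem lintegral_mOp_wexp_le {σ : ℝ} (hσ : 1 < σ) {a b : ℝ} (hab : a < b) :
    ∫⁻ x in Set.Ioo a b, mOp ((Set.Ioo a b).indicator wexp) x
      ≤ ENNReal.ofReal (2 / (σ - 1)) * ∫⁻ x in dil σ a b, wexp x := by
  have hσ' : 0 < σ - 1 := sub_pos.2 hσ
  have hδ : 0 < (σ - 1) * (b - a) / 2 := by
    have := sub_pos.2 hab
    positivity
  have hle : ∀ y, (Set.Ioo a b).indicator wexp y ≤ ENNReal.ofReal (Real.exp b) := by
    intro y
    refine Set.indicator_apply_le' (fun hy => ?_) fun _ => zero_le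
    exact ENNReal.ofReal_le_ofReal (Real.exp_le_exp.2 hy.2.le)
  calc ∫⁻ x in Set.Ioo a b, mOp ((Set.Ioo a b).indicator wexp) x
      ≤ ∫⁻ _ in Set.Ioo a b, ENNReal.ofReal (Real.exp b) :=
        lintegral_mono fun x => mOp_le_of_le hle x
    _ = ENNReal.ofReal (2 / (σ - 1) * ((σ - 1) * (b - a) / 2 * Real.exp b)) := by
        rw [setLIntegral_const, Real.volume_Ioo, ← ENNReal.ofReal_mul (Real.exp_pos b).le]
        congr 1
        field_simp
    _ = ENNReal.ofReal (2 / (σ - 1)) * ENNReal.ofReal ((σ - 1) * (b - a) / 2 * Real.exp b) :=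
        ENNReal.ofReal_mul (by positivity)
    _ ≤ ENNReal.ofReal (2 / (σ - 1)) *
          ∫⁻ x in Set.Ioo b (b + (σ - 1) * (b - a) / 2), wexp x := by
        rw [lintegral_wexp_Ioo (by linarith)]
        gcongr
        rw [Real.exp_add]
        nlinarith [Real.add_one_le_exp ((σ - 1) * (b - a) / 2), Real.exp_pos b]
    _ ≤ ENNReal.ofReal (2 / (σ - 1)) * ∫⁻ x in dil σ a b, wexp x := by
        gcongr
        exact Set.Ioo_subset_Ioo (by linarith) (by linarith)

theorem exp_mul_lintegral_wexp_le (k : ℕ) :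
    ENNReal.ofReal (Real.exp k) * ∫⁻ x in Set.Ioo (k : ℝ) (3 * k), wexp x
      ≤ ∫⁻ x in dil 2 (k : ℝ) (3 * k), wexp x := by
  have hk : (0 : ℝ) ≤ k := k.cast_nonneg
  have hdil : dil 2 (k : ℝ) (3 * k) = Set.Ioo 0 (4 * (k : ℝ)) := by
    unfold dil
    congr 1 <;> ring
  rw [hdil, lintegral_wexp_Ioo (by linarith), lintegral_wexp_Ioo (by linarith),
    ← ENNReal.ofReal_mul (Real.exp_pos _).le, mul_sub, ← Real.exp_add, ← Real.exp_add]
  apply ENNReal.ofReal_le_ofReal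
  rw [show (k : ℝ) + 3 * k = 4 * k by ring]
  gcongr
  linarith

/-- The weight `e^x` on `ℝ` belongs to `A_∞^σ` for every `σ > 1` (with constant
`2/(σ-1)`), but the measure `e^x dx` is not doubling, so `e^x ∉ A_∞`. -/
theorem exp_mem_weak_Ainfty_not_doubling :
    (∀ σ : ℝ, 1 < σ →
      (∀ a b : ℝ, a < b →
        ∫⁻ x in Set.Ioo a b, mOp ((Set.Ioo a b).indicator wexp) x
          ≤ ENNReal.ofReal (2 / (σ - 1)) * ∫⁻ x in dil σ a b, wexp x) ∧
      ∃ C : ℝ≥0∞, C ≠ ⊤ ∧ ∀ a b : ℝ, a < b →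
        ∫⁻ x in Set.Ioo a b, mOp ((Set.Ioo a b).indicator wexp) x
          ≤ C * ∫⁻ x in dil σ a b, wexp x) ∧
    (∀ k : ℕ,
      ENNReal.ofReal (Real.exp k) * ∫⁻ x in Set.Ioo (k : ℝ) (3 * k), wexp x
        ≤ ∫⁻ x in dil 2 (k : ℝ) (3 * k), wexp x) ∧
    (∀ C : ℝ≥0∞, C ≠ ⊤ → ∃ a b : ℝ, a < b ∧
      C * ∫⁻ x in Set.Ioo a b, wexp x < ∫⁻ x in dil 2 a b, wexp x) := by
  refine ⟨fun σ hσ => ⟨fun a b hab => lintegral_mOp_wexp_le hσ hab, _, ENNReal.ofReal_ne_top,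
    fun a b hab => lintegral_mOp_wexp_le hσ hab⟩, exp_mul_lintegral_wexp_le, fun C hC => ?_⟩
  obtain ⟨k, hk⟩ := exists_nat_gt C.toReal
  have hk0 : (0 : ℝ) < k := ENNReal.toReal_nonneg.trans_lt hk
  have hCk : C < ENNReal.ofReal (Real.exp k) := by
    rw [ENNReal.lt_ofReal_iff_toReal_lt hC]
    linarith [Real.add_one_le_exp (k : ℝ)]
  have hlt : (k : ℝ) < 3 * k := by linarith
  refine ⟨k, 3 * k, hlt, lt_of_lt_of_le ?_ (exp_mul_lintegral_wexp_le k)⟩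
  rw [lintegral_wexp_Ioo hlt.le]
  refine ENNReal.mul_lt_mul_left ?_ ENNReal.ofReal_ne_top hCk
  simpa using hlt

end ExpWeight
end

section
/- Let (X,ρ,μ) be a space of homogeneous type with doubling constant D, let σ ≥ 1, p > 1, C > 0, and let w be a weight satisfying w(E) ≤ C·(μ(E)/μ(B))^{1/p}·w(σB) for every ball B and every measurable E ⊆ B. Then for every r with 1 ≤ r < 1 + 1/p and every ball B one has (⨍_B w^r dμ)^{1/r} ≤ p²·C·D^{log₂ σ + 1}·⨍_{σB} w dμ; in particular w ∈ RH_r^σ for every such r > 1. -/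
open MeasureTheory ENNReal

namespace SHT

variable {X : Type*}

/-- A function with a weak-`L^q` bound on a finite measure space is in `L^r` for `1 ≤ r < q`. -/
lemma lintegral_rpow_le_of_weakType {α : Type*} [MeasurableSpace α] {ν : Measure α}
    {f : α → ℝ≥0∞} (hf : Measurable f) (hf_top : ∀ᵐ y ∂ν, f y < ⊤) {V : ℝ≥0∞}
    (hV : ν Set.univ ≤ V) {K q r : ℝ} (hK : 0 < K) (hr : 1 ≤ r) (hrq : r < q)
    (hweak : ∀ t : ℝ, 0 < t → ν {y | ENNReal.ofReal t < f y} ≤ V * ENNReal.ofReal ((K / t) ^ q)) :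
    ∫⁻ y, f y ^ r ∂ν ≤ V * ENNReal.ofReal (q / (q - r) * K ^ r) := by
  have hr0 : 0 < r := by linarith
  have hqr : 0 < q - r := by linarith
  have hdist : ∀ t : ℝ, 0 < t →
      ν {y | t < (f y).toReal} ≤ ν {y | ENNReal.ofReal t < f y} := by
    intro t ht
    refine measure_mono fun y hy => ?_
    rcases eq_or_ne (f y) ⊤ with htop | htop
    · simp [htop]
    · exact (ENNReal.ofReal_lt_iff_lt_toReal ht.le htop).2 hy
  have hpow : ∫⁻ y, f y ^ r ∂ν = ∫⁻ y, ENNReal.ofReal ((f y).toReal ^ r) ∂ν := by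
    refine lintegral_congr_ae ?_
    filter_upwards [hf_top] with y hy
    rw [← ENNReal.ofReal_rpow_of_nonneg ENNReal.toReal_nonneg hr0.le,
      ENNReal.ofReal_toReal hy.ne]
  have hsmall : ∫⁻ t in Set.Ioc 0 K, ENNReal.ofReal (t ^ (r - 1)) = ENNReal.ofReal (K ^ r / r) := by
    rw [← ofReal_integral_eq_lintegral_ofReal]
    · rw [← intervalIntegral.integral_of_le hK.le, integral_rpow (Or.inl (by linarith))]
      simp [Real.zero_rpow hr0.ne']
    · exact (intervalIntegrable_iff_integrableOn_Ioc_of_le hK.le).1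
        (intervalIntegral.intervalIntegrable_rpow' (by linarith))
    · exact (ae_restrict_mem measurableSet_Ioc).mono fun t ht => Real.rpow_nonneg ht.1.le _
  have hlarge : ∫⁻ t in Set.Ioi K, ENNReal.ofReal (K ^ q * t ^ (r - 1 - q)) =
      ENNReal.ofReal (K ^ r / (q - r)) := by
    rw [← ofReal_integral_eq_lintegral_ofReal]
    · rw [integral_const_mul, integral_Ioi_rpow_of_lt (by linarith) hK]
      congr 1
      have hK' : K ^ r = K ^ q * K ^ (r - 1 - q + 1) := by
        rw [← Real.rpow_add hK]; ring_nf
      rw [hK', show r - 1 - q + 1 = -(q - r) by ring, neg_div_neg_eq]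
      ring
    · exact (integrableOn_Ioi_rpow_of_lt (by linarith) hK).const_mul _
    · exact (ae_restrict_mem measurableSet_Ioi).mono fun t ht =>
        mul_nonneg (Real.rpow_nonneg hK.le _) (Real.rpow_nonneg (hK.trans ht).le _)
  rw [hpow, lintegral_rpow_eq_lintegral_meas_lt_mul ν (ae_of_all _ fun _ => ENNReal.toReal_nonneg)
    hf.ennreal_toReal.aemeasurable hr0, ← Set.Ioc_union_Ioi_eq_Ioi hK.le,
    lintegral_union measurableSet_Ioi (Set.Ioc_disjoint_Ioi le_rfl)]
  calc
    _ ≤ ENNReal.ofReal r * ((∫⁻ t in Set.Ioc 0 K, V * ENNReal.ofReal (t ^ (r - 1))) +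
          ∫⁻ t in Set.Ioi K, V * ENNReal.ofReal (K ^ q * t ^ (r - 1 - q))) := by
      gcongr ENNReal.ofReal r * (?_ + ?_)
      · exact lintegral_mono fun t => by
          gcongr
          exact (measure_mono (Set.subset_univ _)).trans hV
      · refine setLIntegral_mono' measurableSet_Ioi fun t ht => ?_
        have ht0 : 0 < t := hK.trans ht
        refine (mul_le_mul_left ((hdist t ht0).trans (hweak t ht0)) _).trans_eq ?_
        rw [mul_assoc, ← ENNReal.ofReal_mul (by positivity), Real.div_rpow hK.le ht0.le,
          Real.rpow_sub ht0 (r - 1) q]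
        ring_nf
    _ = V * ENNReal.ofReal (q / (q - r) * K ^ r) := by
      rw [lintegral_const_mul _ (by fun_prop), lintegral_const_mul _ (by fun_prop), hsmall, hlarge,
        ← mul_add, ← ENNReal.ofReal_add (by positivity) (by positivity), mul_left_comm,
        ← ENNReal.ofReal_mul hr0.le]
      congr 2
      field_simp
      ring

lemma le_rpow_of_mul_le_mul_rpow {m t K p : ℝ} (hm : 0 ≤ m) (ht : 0 < t) (hK : 0 ≤ K) (hp : 1 < p)
    (h : t * m ≤ K * m ^ (1 / p)) : m ≤ (K / t) ^ (p / (p - 1)) := by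
  rcases hm.eq_or_lt with rfl | hm
  · positivity
  have hp1 : 0 < p - 1 := by linarith
  have hsplit : m = m ^ (1 / p) * m ^ ((p - 1) / p) := by
    rw [← Real.rpow_add hm, ← add_div, add_sub_cancel, div_self (by linarith), Real.rpow_one]
  have hle : m ^ ((p - 1) / p) ≤ K / t := by
    rw [le_div_iff₀ ht]
    refine le_of_mul_le_mul_left ?_ (Real.rpow_pos_of_pos hm (1 / p))
    rw [← mul_assoc, ← hsplit]
    linarith
  calc m = (m ^ ((p - 1) / p)) ^ (p / (p - 1)) := by
        rw [← Real.rpow_mul hm.le, div_mul_div_cancel₀' hp1.ne', div_self (by linarith),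
          Real.rpow_one]
    _ ≤ _ := by gcongr

lemma IsSHT.one_le_doubling [MeasurableSpace X] {ρ : X → X → ℝ} {μ : Measure X} {κ D : ℝ}
    (hX : IsSHT ρ μ κ D) (x : X) : 1 ≤ D := by
  have hle : 1 * μ (qball ρ x 1) ≤ ENNReal.ofReal D * μ (qball ρ x 1) := by
    rw [one_mul]
    refine (measure_mono fun y (hy : ρ x y < 1) => ?_).trans (hX.doubling x 1)
    exact hy.trans (by norm_num)
  rw [ENNReal.mul_le_mul_iff_left (hX.ball_pos x 1 one_pos).ne' (hX.ball_lt_top x 1).ne,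
    ENNReal.one_le_ofReal] at hle
  exact hle

lemma IsSHT.measure_qball_mul_le [MeasurableSpace X] {ρ : X → X → ℝ} {μ : Measure X} {κ D : ℝ}
    (hX : IsSHT ρ μ κ D) {σ : ℝ} (hσ : 1 ≤ σ) (x : X) {s : ℝ} (hs : 0 < s) :
    μ (qball ρ x (σ * s)) ≤ ENNReal.ofReal (D ^ (Real.logb 2 σ + 1)) * μ (qball ρ x s) := by
  have hD := hX.one_le_doubling x
  have hiter : ∀ n : ℕ, μ (qball ρ x (2 ^ n * s)) ≤ ENNReal.ofReal D ^ n * μ (qball ρ x s) := by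
    intro n
    induction n with
    | zero => simp
    | succ n ih =>
      rw [pow_succ', mul_assoc, pow_succ', mul_assoc]
      exact (hX.doubling x _).trans (by gcongr)
  set n := ⌈Real.logb 2 σ⌉₊
  have hσn : σ ≤ 2 ^ n := by
    rw [← Real.rpow_natCast, ← Real.logb_le_iff_le_rpow one_lt_two (by linarith)]
    exact Nat.le_ceil _
  calc μ (qball ρ x (σ * s)) ≤ μ (qball ρ x (2 ^ n * s)) :=
        measure_mono fun y (hy : ρ x y < _) => hy.trans_le (by gcongr)
    _ ≤ ENNReal.ofReal D ^ n * μ (qball ρ x s) := hiter n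
    _ ≤ _ := by
      gcongr
      rw [← ENNReal.ofReal_pow (by linarith), ← Real.rpow_natCast]
      exact ENNReal.ofReal_le_ofReal (Real.rpow_le_rpow_of_exponent_le hD
        (Nat.ceil_lt_add_one (Real.logb_nonneg one_lt_two hσ)).le)

/-- The reverse Hölder bound on a fixed set, with the average of `w` over the larger set
normalised by the measure of the smaller one. -/
lemma avg_rpow_le_of_lintegral_le [MeasurableSpace X] {μ : Measure X} {B : Set X}
    (hB : MeasurableSet B) (hB0 : μ B ≠ 0) (hB_top : μ B ≠ ⊤) {w : X → ℝ≥0∞} (hw : Measurable w)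
    (hwB : ∫⁻ y in B, w y ∂μ ≠ ⊤) {p K : ℝ} (hp : 1 < p) (hK : 0 ≤ K)
    (h : ∀ E : Set X, MeasurableSet E → E ⊆ B →
      ∫⁻ y in E, w y ∂μ ≤ ENNReal.ofReal K * (μ E / μ B) ^ (1 / p) * μ B)
    {r : ℝ} (hr : 1 ≤ r) (hrp : r < 1 + 1 / p) :
    (avg μ B (fun y => w y ^ r)) ^ (1 / r) ≤ ENNReal.ofReal (p ^ 2) * ENNReal.ofReal K := by
  have hp0 : 0 < p := by linarith
  have hp1 : 0 < p - 1 := by linarith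
  have hr0 : 0 < r := by linarith
  rcases hK.eq_or_lt with rfl | hK
  · have hzero : ∫⁻ y in B, w y ∂μ = 0 := by simpa using h B hB subset_rfl
    have hzero' : ∫⁻ y in B, w y ^ r ∂μ = 0 := by
      rw [lintegral_eq_zero_iff hw] at hzero
      rw [lintegral_eq_zero_iff (by fun_prop)]
      filter_upwards [hzero] with y hy
      simp [hy, hr0]
    simp [avg, hzero', hr0]
  obtain ⟨hq_le, hrq⟩ : p / (p - 1) / (p / (p - 1) - r) ≤ p ^ 2 ∧ r < p / (p - 1) := by
    have hgap : 1 / (p * (p - 1)) ≤ p / (p - 1) - r := by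
      have : p / (p - 1) - (1 + 1 / p) = 1 / (p * (p - 1)) := by field_simp; ring
      linarith
    have hgap0 : 0 < p / (p - 1) - r := lt_of_lt_of_le (by positivity) hgap
    refine ⟨?_, by linarith⟩
    rw [div_le_iff₀ hgap0]
    calc p / (p - 1) = p ^ 2 * (1 / (p * (p - 1))) := by field_simp
      _ ≤ _ := by gcongr
  have hweak : ∀ t : ℝ, 0 < t → μ.restrict B {y | ENNReal.ofReal t < w y} ≤
      μ B * ENNReal.ofReal ((K / t) ^ (p / (p - 1))) := by
    intro t ht
    have hmeas : MeasurableSet {y | ENNReal.ofReal t < w y} := measurableSet_lt (by fun_prop) hw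
    rw [Measure.restrict_apply hmeas]
    set E := {y | ENNReal.ofReal t < w y} ∩ B
    have hE_le : μ E ≤ μ B := measure_mono Set.inter_subset_right
    have hm_top : μ E / μ B ≠ ⊤ := ENNReal.div_ne_top (ne_top_of_le_ne_top hB_top hE_le) hB0
    have hcheb : ENNReal.ofReal t * μ E ≤ ENNReal.ofReal K * (μ E / μ B) ^ (1 / p) * μ B :=
      (setLIntegral_const E _).symm.trans_le
        ((setLIntegral_mono hw fun y hy => hy.1.le).trans
          (h E (hmeas.inter hB) Set.inter_subset_right))
    have hE : μ E = μ E / μ B * μ B := (ENNReal.div_mul_cancel hB0 hB_top).symm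
    rw [hE, ← mul_assoc, ENNReal.mul_div_cancel_right hB0 hB_top,
      ENNReal.mul_le_mul_iff_left hB0 hB_top] at hcheb
    have hreal := ENNReal.toReal_mono (by finiteness) hcheb
    rw [ENNReal.toReal_mul, ENNReal.toReal_mul, ENNReal.toReal_ofReal ht.le,
      ENNReal.toReal_ofReal hK.le, ← ENNReal.toReal_rpow] at hreal
    rw [hE, mul_comm]
    gcongr
    exact ENNReal.le_ofReal_iff_toReal_le hm_top (by positivity) |>.2
      (le_rpow_of_mul_le_mul_rpow ENNReal.toReal_nonneg ht hK.le hp hreal)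
  have hint := lintegral_rpow_le_of_weakType hw (ae_lt_top hw hwB)
    (Measure.restrict_apply_univ B).le hK hr hrq hweak
  have hp2 : 1 ≤ p ^ 2 := one_le_pow₀ hp.le
  calc (avg μ B (fun y => w y ^ r)) ^ (1 / r)
      ≤ ENNReal.ofReal (p ^ 2 * K ^ r) ^ (1 / r) := by
        gcongr
        rw [avg]
        refine (mul_le_mul_right hint _).trans ?_
        rw [← mul_assoc, ENNReal.inv_mul_cancel hB0 hB_top, one_mul]
        refine ENNReal.ofReal_le_ofReal ?_
        gcongr
    _ = ENNReal.ofReal ((p ^ 2) ^ (1 / r) * K) := by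
        rw [ENNReal.ofReal_rpow_of_nonneg (by positivity) (by positivity),
          Real.mul_rpow (by positivity) (by positivity), ← Real.rpow_mul hK.le,
          mul_one_div_cancel hr0.ne', Real.rpow_one]
    _ ≤ ENNReal.ofReal (p ^ 2 * K) := by
        refine ENNReal.ofReal_le_ofReal ?_
        gcongr
        exact Real.rpow_le_self_of_one_le hp2 ((div_le_one hr0).2 hr)
    _ = _ := ENNReal.ofReal_mul (by positivity)

/-- If a weight satisfies the `𝒜_∞^σ`-type condition
`w(E) ≤ C (μ(E)/μ(B))^{1/p} w(σB)`, then for every `1 ≤ r < 1 + 1/p` it satisfies the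
`σ`-weak Reverse Hölder inequality with constant `p²·C·D^{log₂ σ + 1}`. -/
theorem scrA_imp_memRH [MeasurableSpace X] (ρ : X → X → ℝ) (μ : Measure X)
    (κ D : ℝ) (hX : IsSHT ρ μ κ D) (σ p C : ℝ) (hσ : 1 ≤ σ) (hp : 1 < p) (hC : 0 < C)
    (w : X → ℝ≥0∞) (hw : IsWeight ρ μ w)
    (h : ∀ (x : X) (r : ℝ), 0 < r → ∀ E : Set X, MeasurableSet E → E ⊆ qball ρ x r →
      ∫⁻ y in E, w y ∂μ
        ≤ ENNReal.ofReal C * (μ E / μ (qball ρ x r)) ^ (1 / p)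
            * ∫⁻ y in qball ρ x (σ * r), w y ∂μ) :
    ∀ r : ℝ, 1 ≤ r → r < 1 + 1 / p →
      (∀ (x : X) (s : ℝ), 0 < s →
        (avg μ (qball ρ x s) (fun y => w y ^ r)) ^ (1 / r)
          ≤ ENNReal.ofReal (p ^ 2 * C * D ^ (Real.logb 2 σ + 1))
              * avg μ (qball ρ x (σ * s)) w) ∧
      (1 < r → MemRH ρ μ r σ w) := by
  intro r hr hrp
  have hRH : ∀ (x : X) (s : ℝ), 0 < s →
      (avg μ (qball ρ x s) (fun y => w y ^ r)) ^ (1 / r)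
        ≤ ENNReal.ofReal (p ^ 2 * C * D ^ (Real.logb 2 σ + 1))
            * avg μ (qball ρ x (σ * s)) w := by
    intro x s hs
    have hD : 0 ≤ D := zero_le_one.trans (hX.one_le_doubling x)
    have hB0 : μ (qball ρ x s) ≠ 0 := (hX.ball_pos x s hs).ne'
    have hB_top : μ (qball ρ x s) ≠ ⊤ := (hX.ball_lt_top x s).ne
    have hS0 : μ (qball ρ x (σ * s)) ≠ 0 := (hX.ball_pos x _ (by positivity)).ne'
    have hS_top : μ (qball ρ x (σ * s)) ≠ ⊤ := (hX.ball_lt_top x _).ne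
    set W := ENNReal.ofReal C * ((μ (qball ρ x s))⁻¹ * ∫⁻ y in qball ρ x (σ * s), w y ∂μ)
      with hW
    have hW_top : W ≠ ⊤ := ENNReal.mul_ne_top ENNReal.ofReal_ne_top
      (ENNReal.mul_ne_top (ENNReal.inv_ne_top.2 hB0) (hw.2 x (σ * s)).ne)
    have hbound := avg_rpow_le_of_lintegral_le (hX.ball_measurable x s) hB0 hB_top hw.1
      (hw.2 x s).ne hp (K := W.toReal) ENNReal.toReal_nonneg (fun E hE hEB => by
        refine (h x s hs E hE hEB).trans_eq ?_
        rw [ENNReal.ofReal_toReal hW_top, hW]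
        calc _ = ENNReal.ofReal C * (μ E / μ (qball ρ x s)) ^ (1 / p)
              * ((∫⁻ y in qball ρ x (σ * s), w y ∂μ)
                * ((μ (qball ρ x s))⁻¹ * μ (qball ρ x s))) := by
                rw [ENNReal.inv_mul_cancel hB0 hB_top, mul_one]
          _ = _ := by ring) hr hrp
    rw [ENNReal.ofReal_toReal hW_top, hW] at hbound
    have hinv : (μ (qball ρ x s))⁻¹ ≤
        ENNReal.ofReal (D ^ (Real.logb 2 σ + 1)) * (μ (qball ρ x (σ * s)))⁻¹ := by
      rw [← div_eq_mul_inv, ENNReal.le_div_iff_mul_le (Or.inl hS0) (Or.inl hS_top), mul_comm,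
        ← div_eq_mul_inv]
      exact ENNReal.div_le_of_le_mul (hX.measure_qball_mul_le hσ x hs)
    refine hbound.trans ?_
    rw [avg, ENNReal.ofReal_mul (by positivity), ENNReal.ofReal_mul (by positivity)]
    simp only [mul_assoc]
    gcongr ENNReal.ofReal (p ^ 2) * (ENNReal.ofReal C * ?_)
    rw [← mul_assoc (ENNReal.ofReal (D ^ _))]
    gcongr
  exact ⟨hRH, fun _ => ⟨_, ENNReal.ofReal_ne_top, hRH⟩⟩

end SHT
end

section
/- The metric measure space (X,d,μ) described below is Ahlfors 1-regular: there exist constants 0 < c ≤ C < ∞ such that c·r ≤ μ(B(x,r)) ≤ C·r for every x ∈ X and every r > 0, where B(x,r) is the ball in (X,d). In particular, μ is a doubling measure on X. -/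
open MeasureTheory ENNReal

namespace Counterexample

/-- The infinite line `A = ℝ × {0}`. -/
def lineA : Set (ℝ × ℝ) := {p | p.2 = 0}

/-- The slanted segment `U = {(u, u/2) : u ∈ (0,1]}`. -/
def segU : Set (ℝ × ℝ) := {p | ∃ u : ℝ, 0 < u ∧ u ≤ 1 ∧ p = (u, u / 2)}

/-- The vertical segment `V = {1} × [1/2, 1]`. -/
def segV : Set (ℝ × ℝ) := {p | p.1 = 1 ∧ 1 / 2 ≤ p.2 ∧ p.2 ≤ 1}

/-- `W = U ∪ V`. -/
def segW : Set (ℝ × ℝ) := segU ∪ segV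

/-- `W_j = W + (10j, 0)`. -/
def segWj (j : ℕ) : Set (ℝ × ℝ) := (fun p => p + ((10 * j : ℝ), 0)) '' segW

/-- The space `X = A ∪ ⋃_j W_j`.  (Recall that the product metric on `ℝ × ℝ` in Mathlib is
exactly the sup-metric `d((u₁,v₁),(u₂,v₂)) = max(|u₁-u₂|, |v₁-v₂|)`.) -/
def spaceX : Set (ℝ × ℝ) := lineA ∪ ⋃ j : ℕ, segWj j

/-- The one-dimensional Hausdorff measure on `X`, realized as the restriction to `X` of the
one-dimensional Hausdorff measure of `(ℝ², ℓ^∞)`. -/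
noncomputable def muX : Measure (ℝ × ℝ) := (μH[1]).restrict spaceX

/-- The ball of `X` centered at `z ∈ X` of radius `r`, as a subset of `ℝ × ℝ`. -/
def ballX (z : ℝ × ℝ) (r : ℝ) : Set (ℝ × ℝ) := Metric.ball z r ∩ spaceX

theorem mem_lineA_spaceX (t : ℝ) : ((t, 0) : ℝ × ℝ) ∈ spaceX := Or.inl rfl

theorem mem_segU_spaceX (j : ℕ) {u : ℝ} (h0 : 0 < u) (h1 : u ≤ 1) :
    ((10 * j + u, u / 2) : ℝ × ℝ) ∈ spaceX := by
  refine Or.inr (Set.mem_iUnion.2 ⟨j, (u, u / 2), Or.inl ⟨u, h0, h1, rfl⟩, ?_⟩)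
  ext <;> simp [add_comm]

theorem mem_segV_spaceX (j : ℕ) {v : ℝ} (h0 : 1 / 2 ≤ v) (h1 : v ≤ 1) :
    ((10 * j + 1, v) : ℝ × ℝ) ∈ spaceX := by
  refine Or.inr (Set.mem_iUnion.2 ⟨j, (1, v), Or.inr ⟨rfl, h0, h1⟩, ?_⟩)
  ext <;> simp [add_comm]

theorem mem_segWj_iff {j : ℕ} {p : ℝ × ℝ} :
    p ∈ segWj j ↔ (∃ u : ℝ, 0 < u ∧ u ≤ 1 ∧ p = (10 * (j : ℝ) + u, u / 2)) ∨
      ∃ v : ℝ, 1 / 2 ≤ v ∧ v ≤ 1 ∧ p = (10 * (j : ℝ) + 1, v) := by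
  constructor
  · rintro ⟨q, ⟨u, h0, h1, rfl⟩ | ⟨hq, h0, h1⟩, rfl⟩
    · exact Or.inl ⟨u, h0, h1, by ext <;> simp [add_comm]⟩
    · exact Or.inr ⟨q.2, h0, h1, by ext <;> simp [hq, add_comm]⟩
  · rintro (⟨u, h0, h1, rfl⟩ | ⟨v, h0, h1, rfl⟩)
    · exact ⟨(u, u / 2), Or.inl ⟨u, h0, h1, rfl⟩, by ext <;> simp [add_comm]⟩
    · exact ⟨(1, v), Or.inr ⟨rfl, h0, h1⟩, by ext <;> simp [add_comm]⟩

theorem mem_ball_iff {p x : ℝ × ℝ} {r : ℝ} :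
    p ∈ Metric.ball x r ↔ |p.1 - x.1| < r ∧ |p.2 - x.2| < r := by
  rw [Metric.mem_ball, Prod.dist_eq, max_lt_iff, Real.dist_eq, Real.dist_eq]

theorem muX_ballX (x : ℝ × ℝ) (r : ℝ) : muX (ballX x r) = μH[1] (ballX x r) :=
  Measure.restrict_eq_self _ Set.inter_subset_right

/-- A set whose image under a `1`-Lipschitz function covers an interval has at least the length of
that interval as its one-dimensional Hausdorff measure. -/
theorem ofReal_sub_le_hausdorffMeasure {E : Type*} [MetricSpace E] [MeasurableSpace E]
    [BorelSpace E] {f : E → ℝ} (hf : LipschitzWith 1 f) {s : Set E} {a b : ℝ}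
    (h : Set.Ioo a b ⊆ f '' s) : ENNReal.ofReal (b - a) ≤ μH[1] s := by
  rw [← Real.volume_Ioo, ← hausdorffMeasure_real]
  refine (measure_mono h).trans ?_
  simpa using hf.hausdorffMeasure_image_le zero_le_one s

/-- On a set where `p ↦ p.1 + p.2` is antilipschitz with constant `2`, the Hausdorff measure of
balls grows at most linearly. -/
theorem hausdorffMeasure_inter_ball_le {S : Set (ℝ × ℝ)}
    (hS : ∀ p ∈ S, ∀ q ∈ S, dist p q ≤ 2 * |(p.1 + p.2) - (q.1 + q.2)|) (x : ℝ × ℝ) (r : ℝ) :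
    μH[1] (Metric.ball x r ∩ S) ≤ ENNReal.ofReal (8 * r) := by
  set T := Metric.ball x r ∩ S
  let f : T → ℝ := fun p => p.1.1 + p.1.2
  have hf : AntilipschitzWith 2 f := AntilipschitzWith.of_le_mul_dist fun p q => by
    simpa [Real.dist_eq, Subtype.dist_eq] using hS p p.2.2 q q.2.2
  have himage : f '' Set.univ ⊆ Set.Ioo (x.1 + x.2 - 2 * r) (x.1 + x.2 + 2 * r) := by
    rintro _ ⟨p, -, rfl⟩
    obtain ⟨h1, h2⟩ := mem_ball_iff.1 p.2.1
    rw [abs_lt] at h1 h2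
    constructor <;> simp only [f] <;> linarith
  calc μH[1] T = μH[1] (Subtype.val '' (Set.univ : Set T)) := by simp
    _ = μH[1] (Set.univ : Set T) :=
        isometry_subtype_coe.hausdorffMeasure_image (Or.inl zero_le_one) _
    _ ≤ 2 * μH[1] (f '' Set.univ) := by
        simpa using hf.le_hausdorffMeasure_image zero_le_one Set.univ
    _ ≤ 2 * ENNReal.ofReal (4 * r) := by
        refine mul_le_mul_right ((measure_mono himage).trans_eq ?_) _
        rw [hausdorffMeasure_real, Real.volume_Ioo]
        ring_nf
    _ = ENNReal.ofReal (8 * r) := by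
        rw [← ENNReal.ofReal_ofNat 2, ← ENNReal.ofReal_mul zero_le_two]
        ring_nf

theorem dist_le_of_mem_lineA {p q : ℝ × ℝ} (hp : p ∈ lineA) (hq : q ∈ lineA) :
    dist p q ≤ 2 * |(p.1 + p.2) - (q.1 + q.2)| := by
  change _ = _ at hp hq
  rw [Prod.dist_eq, Real.dist_eq, Real.dist_eq, hp, hq]
  simp only [add_zero, sub_zero, abs_zero]
  exact max_le (by linarith [abs_nonneg (p.1 - q.1)]) (by positivity)

theorem dist_le_of_mem_segWj {j k : ℕ} {p q : ℝ × ℝ} (hp : p ∈ segWj j) (hq : q ∈ segWj k) :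
    dist p q ≤ 2 * |(p.1 + p.2) - (q.1 + q.2)| := by
  wlog hjk : j ≤ k generalizing j k p q
  · rw [dist_comm, abs_sub_comm]
    exact this hq hp (not_le.1 hjk).le
  rw [Prod.dist_eq, Real.dist_eq, Real.dist_eq]
  rw [mem_segWj_iff] at hp hq
  obtain rfl | hlt := hjk.eq_or_lt
  · rcases hp with ⟨u, h0, h1, rfl⟩ | ⟨u, h0, h1, rfl⟩ <;>
      rcases hq with ⟨v, h2, h3, rfl⟩ | ⟨v, h2, h3, rfl⟩ <;>
      dsimp only <;> grind
  · have hjk' : (j : ℝ) + 1 ≤ k := by exact_mod_cast hlt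
    rcases hp with ⟨u, h0, h1, rfl⟩ | ⟨u, h0, h1, rfl⟩ <;>
      rcases hq with ⟨v, h2, h3, rfl⟩ | ⟨v, h2, h3, rfl⟩ <;>
      dsimp only <;> grind

theorem hausdorffMeasure_ballX_le (x : ℝ × ℝ) {r : ℝ} (hr : 0 < r) :
    μH[1] (ballX x r) ≤ ENNReal.ofReal (16 * r) := by
  rw [ballX, spaceX, Set.inter_union_distrib_left]
  refine (measure_union_le _ _).trans ((add_le_add
    (hausdorffMeasure_inter_ball_le (fun p hp q hq => dist_le_of_mem_lineA hp hq) x r)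
    (hausdorffMeasure_inter_ball_le (fun p hp q hq => ?_) x r)).trans_eq ?_)
  · obtain ⟨j, hj⟩ := Set.mem_iUnion.1 hp
    obtain ⟨k, hk⟩ := Set.mem_iUnion.1 hq
    exact dist_le_of_mem_segWj hj hk
  · rw [← ENNReal.ofReal_add (by positivity) (by positivity)]
    ring_nf

/-- If the ball reaches the line `A` vertically, it contains a full interval of `A`. -/
theorem le_hausdorffMeasure_ballX_of_abs_lt {x : ℝ × ℝ} {r : ℝ} (hx : |x.2| < r) :
    ENNReal.ofReal (1 / 4 * r) ≤ μH[1] (ballX x r) := by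
  have hr : 0 < r := (abs_nonneg _).trans_lt hx
  refine (ENNReal.ofReal_le_ofReal ?_).trans (ofReal_sub_le_hausdorffMeasure
    (a := x.1 - r) (b := x.1 + r) LipschitzWith.prod_fst fun t ht => ?_)
  · linarith
  · refine ⟨(t, 0), ⟨mem_ball_iff.2 ⟨?_, by simpa using hx⟩, mem_lineA_spaceX t⟩, rfl⟩
    rw [abs_lt]
    constructor <;> linarith [ht.1, ht.2]

theorem le_hausdorffMeasure_ballX {x : ℝ × ℝ} (hx : x ∈ spaceX) {r : ℝ} (hr : 0 < r) :
    ENNReal.ofReal (1 / 4 * r) ≤ μH[1] (ballX x r) := by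
  by_cases hxr : |x.2| < r
  · exact le_hausdorffMeasure_ballX_of_abs_lt hxr
  rw [not_lt] at hxr
  rcases hx with hx | hx
  · rw [show x.2 = 0 from hx, abs_zero] at hxr
    exact absurd hr hxr.not_gt
  obtain ⟨j, hj⟩ := Set.mem_iUnion.1 hx
  rcases mem_segWj_iff.1 hj with ⟨u, h0, h1, rfl⟩ | ⟨v, h0, h1, rfl⟩
  · have hru : r ≤ u / 2 := by simpa [abs_of_pos (half_pos h0)] using hxr
    refine (ENNReal.ofReal_le_ofReal ?_).trans (ofReal_sub_le_hausdorffMeasure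
      (a := 10 * j + u - r) (b := 10 * j + u) LipschitzWith.prod_fst fun t ht => ?_)
    · linarith
    · obtain ⟨ht1, ht2⟩ := ht
      have hmem := mem_segU_spaceX j (u := t - 10 * j) (by linarith) (by linarith)
      refine ⟨_, ⟨mem_ball_iff.2 ?_, hmem⟩, by simp⟩
      simp only [abs_lt]
      refine ⟨⟨?_, ?_⟩, ?_, ?_⟩ <;> linarith
  · have hrv : r ≤ v := by simpa [abs_of_nonneg (show 0 ≤ v by linarith)] using hxr
    by_cases hv : 1 / 2 + r / 4 ≤ v
    · refine (ENNReal.ofReal_le_ofReal ?_).trans (ofReal_sub_le_hausdorffMeasure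
        (a := v - r / 4) (b := v) LipschitzWith.prod_snd fun t ht => ?_)
      · linarith
      · obtain ⟨ht1, ht2⟩ := ht
        have hmem := mem_segV_spaceX j (v := t) (by linarith) (by linarith)
        refine ⟨_, ⟨mem_ball_iff.2 ?_, hmem⟩, rfl⟩
        simp only [abs_lt]
        refine ⟨⟨?_, ?_⟩, ?_, ?_⟩ <;> linarith
    · refine (ENNReal.ofReal_le_ofReal ?_).trans (ofReal_sub_le_hausdorffMeasure
        (a := 10 * j + 1 - r / 4) (b := 10 * j + 1) LipschitzWith.prod_fst fun t ht => ?_)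
      · linarith
      · obtain ⟨ht1, ht2⟩ := ht
        have hmem := mem_segU_spaceX j (u := t - 10 * j) (by linarith) (by linarith)
        refine ⟨_, ⟨mem_ball_iff.2 ?_, hmem⟩, by simp⟩
        simp only [abs_lt]
        refine ⟨⟨?_, ?_⟩, ?_, ?_⟩ <;> linarith

/-- The space `(X, d, μ)` is Ahlfors 1-regular; in particular `μ` is doubling on `X`. -/
theorem spaceX_ahlfors_one_regular :
    ∃ c C : ℝ, 0 < c ∧ c ≤ C ∧
      (∀ x ∈ spaceX, ∀ r : ℝ, 0 < r →
        ENNReal.ofReal (c * r) ≤ muX (ballX x r) ∧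
          muX (ballX x r) ≤ ENNReal.ofReal (C * r)) ∧
      ∃ Dc : ℝ≥0∞, Dc ≠ ⊤ ∧ ∀ x ∈ spaceX, ∀ r : ℝ, 0 < r →
        muX (ballX x (2 * r)) ≤ Dc * muX (ballX x r) := by
  refine ⟨1 / 4, 16, by norm_num, by norm_num, fun x hx r hr => ?_,
    ENNReal.ofReal 128, ENNReal.ofReal_ne_top, fun x hx r hr => ?_⟩
  · rw [muX_ballX]
    exact ⟨le_hausdorffMeasure_ballX hx hr, hausdorffMeasure_ballX_le x hr⟩
  · rw [muX_ballX, muX_ballX]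
    calc μH[1] (ballX x (2 * r)) ≤ ENNReal.ofReal (16 * (2 * r)) :=
          hausdorffMeasure_ballX_le x (by positivity)
      _ = ENNReal.ofReal 128 * ENNReal.ofReal (1 / 4 * r) := by
          rw [← ENNReal.ofReal_mul (by norm_num)]
          ring_nf
      _ ≤ ENNReal.ofReal 128 * μH[1] (ballX x r) := by
          gcongr
          exact le_hausdorffMeasure_ballX hx hr

end Counterexample
end
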